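/- Let φ : (Q, m) → (Q', m') be a local homomorphism of regular local rings making Q' a finite flat Q-module and satisfying mQ' = m'. Let J ⊆ Q' be an ideal generated by a regular sequence on Q', and let f ∈ Q be a nonzero element with φ(f) ∈ J. Then Q'/J, regarded as a module over Q/(f) via the ring map Q/(f) → Q'/J induced by φ, has finite projective dimension over Q/(f) if and only if φ(f) ∉ m'J. -/

import Mathlib

open IsLocalRing

universe u v

/-- A Noetherian local ring is regular if its maximal ideal can be generated by
`dim Q` elements. -/
def IsRegularLocal (Q : Type u) [CommRing Q] [IsLocalRing Q] [IsNoetherianRing Q] : Prop :=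
  ∃ (n : ℕ) (x : Fin n → Q),
    Ideal.span (Set.range x) = maximalIdeal Q ∧ ringKrullDim Q = n

/-- `ProjDimLE A n M` : the `A`-module `M` has projective dimension at most `n`. -/
def ProjDimLE (A : Type u) [CommRing A] :
    ℕ → ∀ (M : Type v) [AddCommGroup M] [Module A M], Prop
  | 0, M, _, _ => Module.Projective A M
  | n + 1, M, _, _ => ∃ (P : Type v) (_ : AddCommGroup P) (_ : Module A P) (g : P →ₗ[A] M),
      Module.Projective A P ∧ Function.Surjective g ∧ ProjDimLE A n (LinearMap.ker g)

/-- An `A`-module `M` has finite projective dimension if it admits a finite-length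
resolution by projective `A`-modules. -/
def HasFinProjDim (A : Type u) [CommRing A] (M : Type v) [AddCommGroup M] [Module A M] : Prop :=
  ∃ n, ProjDimLE A n M



/-- An element of an ideal lying outside the product with the maximal ideal can replace one of
the given generators. -/
theorem Ideal.exists_perm_of_mem_ofList_of_notMem_mul {A : Type*} [CommRing A] [IsLocalRing A]
    (rs : List A) {x : A} (hx : x ∈ Ideal.ofList rs)
    (hx' : x ∉ maximalIdeal A * Ideal.ofList rs) :
    ∃ (r : A) (rs' : List A) (u y : A), (r :: rs').Perm rs ∧ IsUnit u ∧
      y ∈ Ideal.ofList rs' ∧ u * r + y = x := by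
  induction rs generalizing x with
  | nil =>
    simp only [Ideal.ofList_nil, Ideal.mem_bot] at hx
    simp [hx] at hx'
  | cons r rs ih =>
    rw [Ideal.ofList_cons] at hx hx'
    obtain ⟨a, z, hz, rfl⟩ := Ideal.mem_span_singleton_sup.mp hx
    by_cases ha : IsUnit a
    · exact ⟨r, rs, a, z, .refl _, ha, hz, rfl⟩
    have har : a * r ∈ maximalIdeal A * (Ideal.span {r} ⊔ Ideal.ofList rs) :=
      Ideal.mul_mem_mul ((mem_maximalIdeal a).mpr ha)
        (Ideal.mem_sup_left (Ideal.mem_span_singleton_self r))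
    have hz' : z ∉ maximalIdeal A * Ideal.ofList rs := fun h =>
      hx' (Ideal.add_mem _ har (Ideal.mul_mono_right le_sup_right h))
    obtain ⟨r', rs', u, y, hperm, hu, hy, rfl⟩ := ih hz hz'
    refine ⟨r', r :: rs', u, y + a * r, ((List.Perm.swap _ _ _).trans (hperm.cons r)), hu, ?_,
      by ring⟩
    rw [Ideal.ofList_cons]
    exact Ideal.add_mem _ (Ideal.mem_sup_right hy)
      (Ideal.mem_sup_left (Ideal.mul_mem_left _ _ (Ideal.mem_span_singleton_self r)))

theorem Ideal.ofList_eq_of_perm {A : Type*} [CommRing A] {rs rs' : List A} (h : rs.Perm rs') :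
    Ideal.ofList rs = Ideal.ofList rs' :=
  congrArg Ideal.span (Set.ext fun _ => h.mem_iff)

theorem Ideal.ofList_cons_eq_of_isUnit {A : Type*} [CommRing A] (r : A) (rs : List A)
    {u y : A} (hu : IsUnit u) (hy : y ∈ Ideal.ofList rs) :
    Ideal.ofList ((u * r + y) :: rs) = Ideal.ofList (r :: rs) := by
  simp only [Ideal.ofList_cons]
  apply le_antisymm <;> refine sup_le ?_ le_sup_right <;> rw [Ideal.span_singleton_le_iff_mem]
  · exact Ideal.mem_span_singleton_sup.mpr ⟨u, y, hy, rfl⟩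
  · obtain ⟨v, hv⟩ := hu.exists_left_inv
    refine Ideal.mem_span_singleton_sup.mpr
      ⟨v, -(v * y), neg_mem (Ideal.mul_mem_left _ _ hy), ?_⟩
    linear_combination r * hv

/-- A Noetherian local ring with positive dimension contains an element of the maximal ideal
outside its square and outside all minimal primes. -/
theorem IsLocalRing.exists_mem_maximalIdeal_notMem_sq_notMem_minimalPrimes {A : Type*}
    [CommRing A] [IsLocalRing A] [IsNoetherianRing A] (h : 0 < ringKrullDim A) :
    ∃ x ∈ maximalIdeal A, x ∉ maximalIdeal A * maximalIdeal A ∧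
      ∀ p ∈ minimalPrimes A, x ∉ p := by
  classical
  by_contra! hcon
  let s : Finset (Ideal A) := insert (maximalIdeal A * maximalIdeal A)
    (minimalPrimes.finite_of_isNoetherianRing A).toFinset
  have hsub : (maximalIdeal A : Set A) ⊆ ⋃ i ∈ (s : Set (Ideal A)), (id i : Ideal A) := by
    intro x hx
    simp only [s, Finset.coe_insert, Set.Finite.coe_toFinset, Set.mem_iUnion]
    by_cases hx2 : x ∈ maximalIdeal A * maximalIdeal A
    · exact ⟨_, Or.inl rfl, hx2⟩
    · obtain ⟨p, hp, hxp⟩ := hcon x hx hx2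
      exact ⟨p, Or.inr hp, hxp⟩
  rw [Ideal.subset_union_prime (maximalIdeal A * maximalIdeal A)
    (maximalIdeal A * maximalIdeal A)] at hsub
  · obtain ⟨i, hi, hle⟩ := hsub
    simp only [s, Finset.mem_insert, Set.Finite.mem_toFinset] at hi
    rcases hi with rfl | hi
    · have := Submodule.eq_bot_of_le_smul_of_le_jacobson_bot (maximalIdeal A) (maximalIdeal A)
        (IsNoetherian.noetherian _) hle (maximalIdeal_le_jacobson _)
      rw [ringKrullDim_eq_zero_of_isField (isField_iff_maximalIdeal_eq.mpr this)] at h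
      exact h.false
    · have hmi : maximalIdeal A = i :=
        (maximalIdeal.isMaximal A).eq_of_le hi.1.1.ne_top hle
      rw [← maximalIdeal_height_eq_ringKrullDim,
        Ideal.height_eq_zero_iff.mpr (hmi ▸ hi : maximalIdeal A ∈ minimalPrimes A)] at h
      exact h.false
  · intro i hi hne _
    simp only [s, Finset.mem_insert, Set.Finite.mem_toFinset] at hi
    exact (hi.resolve_left hne).1.1

/-- A Noetherian local ring whose maximal ideal is generated by at most `dim A` elements is a
domain. -/
theorem IsLocalRing.isDomain_of_ofList_eq_maximalIdeal (d : ℕ) :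
    ∀ (A : Type u) [CommRing A] [IsLocalRing A] [IsNoetherianRing A] (xs : List A),
      xs.length = d → Ideal.ofList xs = maximalIdeal A → (d : WithBot ℕ∞) ≤ ringKrullDim A →
      IsDomain A := by
  induction d with
  | zero =>
    intro A _ _ _ xs hlen hxs _
    rw [List.length_eq_zero_iff.mp hlen, Ideal.ofList_nil] at hxs
    exact (isField_iff_maximalIdeal_eq.mpr hxs.symm).isDomain
  | succ d ih =>
    intro A _ _ _ xs hlen hxs hdim
    obtain ⟨x, hxm, hx2, hxp⟩ := exists_mem_maximalIdeal_notMem_sq_notMem_minimalPrimes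
      (A := A) (lt_of_lt_of_le (by exact_mod_cast Nat.succ_pos d) hdim)
    obtain ⟨r, rs, u, y, hperm, hu, hy, rfl⟩ :=
      Ideal.exists_perm_of_mem_ofList_of_notMem_mul xs (hxs ▸ hxm) (hxs ▸ hx2)
    set x := u * r + y with hx
    have hgen : Ideal.span {x} ⊔ Ideal.ofList rs = maximalIdeal A := by
      rw [← Ideal.ofList_cons, hx, Ideal.ofList_cons_eq_of_isUnit r rs hu hy,
        Ideal.ofList_eq_of_perm hperm, hxs]
    have hxle : Ideal.span {x} ≤ maximalIdeal A := hgen ▸ le_sup_left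
    have : Nontrivial (A ⧸ Ideal.span {x}) := Ideal.Quotient.nontrivial_iff.mpr
      (ne_top_of_le_ne_top (maximalIdeal.isMaximal A).ne_top hxle)
    have : IsLocalRing (A ⧸ Ideal.span {x}) :=
      .of_surjective' (Ideal.Quotient.mk _) Ideal.Quotient.mk_surjective
    have hdom : IsDomain (A ⧸ Ideal.span {x}) := by
      refine ih (A ⧸ Ideal.span {x}) (rs.map (Ideal.Quotient.mk _)) ?_ ?_ ?_
      · have := hperm.length_eq
        simp only [List.length_cons, hlen] at this
        simpa using this
      · rw [← Ideal.map_ofList, ← map_maximalIdeal_of_surjective (Ideal.Quotient.mk _)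
          Ideal.Quotient.mk_surjective, ← hgen, Ideal.map_sup, Ideal.map_quotient_self, bot_sup_eq]
      · have h := ringKrullDim_le_ringKrullDim_quotient_add_encard {x}
          (by simpa [IsLocalRing.ringJacobson_eq_maximalIdeal] using hxm)
        have h' := hdim.trans h
        simp only [Set.encard_singleton] at h'
        have h1 : ((1 : ℕ) : WithBot ℕ∞) = ((1 : ℕ∞) : WithBot ℕ∞) := rfl
        rw [← h1, Nat.cast_add] at h'
        exact (ENat.WithBot.add_le_add_natCast_right_iff (c := 1)).mp h'
    have hprime : (Ideal.span {x}).IsPrime := (Ideal.Quotient.isDomain_iff_prime _).mp hdom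
    obtain ⟨p, hp, hpx⟩ := Ideal.exists_minimalPrimes_le (bot_le : ⊥ ≤ Ideal.span {x})
    have hpp : p.IsPrime := hp.1.1
    have hple : p ≤ maximalIdeal A • p := by
      intro z hz
      obtain ⟨w, rfl⟩ := Ideal.mem_span_singleton'.mp (hpx hz)
      rw [mul_comm] at hz ⊢
      exact Ideal.mul_mem_mul hxm ((hpp.mem_or_mem hz).resolve_left (hxp p hp))
    have hbot := Submodule.eq_bot_of_le_smul_of_le_jacobson_bot _ p
      (IsNoetherian.noetherian _) hple (maximalIdeal_le_jacobson _)
    subst hbot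
    exact (IsDomain.of_bot_isPrime A)

theorem IsRegularLocal.isDomain {A : Type u} [CommRing A] [IsLocalRing A] [IsNoetherianRing A]
    (h : IsRegularLocal A) : IsDomain A := by
  obtain ⟨n, x, hx, hdim⟩ := h
  refine IsLocalRing.isDomain_of_ofList_eq_maximalIdeal n A (List.ofFn x) (by simp) ?_ hdim.ge
  rw [← hx, Ideal.ofList]
  congr 1
  ext
  simp [List.mem_ofFn]

section MatrixFactorization

variable {A : Type*} [CommRing A]

/-- If `J ≤ I`, every `f ∈ I * J` has a matrix factorization `D * D = f • 1` such that
`D` has all its entries in `I` and one of its rows in `J`. -/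
theorem exists_matrix_mul_self_eq_smul_of_mem_mul {I J : Ideal A} (hJI : J ≤ I) {f : A}
    (hf : f ∈ I * J) :
    ∃ (ι : Type) (_ : Fintype ι) (_ : DecidableEq ι) (D : Matrix ι ι A) (i₀ : ι),
      D * D = f • 1 ∧ (∀ i j, D i j ∈ I) ∧ ∀ j, D i₀ j ∈ J := by
  suffices ∀ g : A, (∃ (ι : Type) (_ : Fintype ι) (_ : DecidableEq ι) (D : Matrix ι ι A) (i₀ : ι),
      D * D = g • 1 ∧ (∀ i j, D i j ∈ I) ∧ ∀ j, D i₀ j ∈ J) →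
      ∃ (ι : Type) (_ : Fintype ι) (_ : DecidableEq ι) (D : Matrix ι ι A) (i₀ : ι),
      D * D = (g + f) • 1 ∧ (∀ i j, D i j ∈ I) ∧ ∀ j, D i₀ j ∈ J by
    simpa using this 0 ⟨Unit, inferInstance, inferInstance, 0, (), by simp, by simp, by simp⟩
  induction hf using Submodule.mul_induction_on' with
  | mem_mul_mem a ha r hr =>
    rintro g ⟨ι, _, _, D, i₀, hD, hDI, hDJ⟩
    refine ⟨ι ⊕ ι, inferInstance, inferInstance, Matrix.fromBlocks D (r • 1) (a • 1) (-D),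
      Sum.inl i₀, ?_, ?_, ?_⟩
    · rw [Matrix.fromBlocks_multiply, ← Matrix.fromBlocks_one, Matrix.fromBlocks_smul]
      congr 1
      · simp [hD, add_smul, smul_smul, mul_comm a r]
      · simp
      · simp
      · simp [hD, add_smul, smul_smul, add_comm, mul_comm a r]
    · have hone : ∀ c ∈ I, ∀ i j, (c • (1 : Matrix ι ι A)) i j ∈ I := fun c hc i j => by
        simpa using Ideal.mul_mem_right _ _ hc
      rintro (i | i) (j | j)
      · exact hDI i j
      · exact hone r (hJI hr) i j
      · exact hone a ha i j
      · exact neg_mem (hDI i j)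
    · rintro (j | j)
      · exact hDJ j
      · simpa using Ideal.mul_mem_right _ _ hr
  | add x hx y hy ihx ihy =>
    intro g hg
    rw [← add_assoc]
    exact ihy _ (ihx g hg)

end MatrixFactorization

section Exactness

variable {A : Type u} [CommRing A] {f : A} {V : Type*} [AddCommGroup V] [Module A V]
  [Module.Projective A V] {D : V →ₗ[A] V}

/-- For a matrix factorization `D ∘ D = f`, the induced complex is exact after applying
`Hom(-, P)` with `P` projective over `A ⧸ (f)`. -/
theorem exists_eq_comp_of_projective (hf : ∀ x : A, f * x = 0 → x = 0)
    (hD : D ∘ₗ D = f • LinearMap.id)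
    (P : Type*) [AddCommGroup P] [Module A P] [Module (A ⧸ Ideal.span {f}) P]
    [IsScalarTower A (A ⧸ Ideal.span {f}) P] [Module.Projective (A ⧸ Ideal.span {f}) P]
    (ψ : V →ₗ[A] P) (hψ : ψ ∘ₗ D = 0) : ∃ χ : V →ₗ[A] P, ψ = χ ∘ₗ D := by
  obtain ⟨s, hs⟩ := Module.projective_def'.mp
    (inferInstance : Module.Projective (A ⧸ Ideal.span {f}) P)
  let q : (P →₀ A) →ₗ[A] (P →₀ A ⧸ Ideal.span {f}) :=
    Finsupp.mapRange.linearMap (Submodule.mkQ (Ideal.span {f}))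
  have hq : Function.Surjective q :=
    Finsupp.mapRange_surjective _ (map_zero _) (Submodule.mkQ_surjective _)
  let s' : P →ₗ[A] (P →₀ A ⧸ Ideal.span {f}) := s.restrictScalars A
  let t : (P →₀ A ⧸ Ideal.span {f}) →ₗ[A] P :=
    (Finsupp.linearCombination (A ⧸ Ideal.span {f}) id).restrictScalars A
  have hts : ∀ p, t (s' p) = p := fun p => LinearMap.congr_fun hs p
  have hfinj : ∀ z : P →₀ A, f • z = 0 → z = 0 := fun z hz => by
    ext p
    exact hf _ (by simpa using DFunLike.congr_fun hz p)
  obtain ⟨ψ', hψ'⟩ := Module.projective_lifting_property q (s' ∘ₗ ψ) hq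
  let m : (P →₀ A) →ₗ[A] (P →₀ A) := f • LinearMap.id
  have hrange : ∀ v, ψ' (D v) ∈ LinearMap.range m := fun v => by
    have h0 : q (ψ' (D v)) = 0 := by
      have h1 := LinearMap.congr_fun hψ' (D v)
      have h2 := LinearMap.congr_fun hψ v
      simp only [LinearMap.comp_apply, LinearMap.zero_apply] at h1 h2
      rw [h1, h2, map_zero]
    have h1 : ∀ p, ∃ c, c * f = ψ' (D v) p := fun p => by
      have := DFunLike.congr_fun h0 p
      simpa [q, Ideal.Quotient.eq_zero_iff_mem, Ideal.mem_span_singleton'] using this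
    choose c hc using h1
    refine ⟨Finsupp.onFinset (ψ' (D v)).support (fun p => c p) fun p hp => ?_, ?_⟩
    · rw [Finsupp.mem_support_iff, ← hc]
      exact fun h => hp (hf _ (by rw [mul_comm, h]))
    · ext p
      simp [m, ← hc, mul_comm]
  obtain ⟨θ, hθ⟩ := Module.projective_lifting_property m.rangeRestrict
    ((ψ' ∘ₗ D).codRestrict _ hrange) m.surjective_rangeRestrict
  have hθ' : ∀ v, f • θ v = ψ' (D v) := fun v =>
    congrArg Subtype.val (LinearMap.congr_fun hθ v)
  have hDD : ∀ v, D (D v) = f • v := fun v => LinearMap.congr_fun hD v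
  have key : ∀ v, ψ' v = θ (D v) := fun v => by
    refine sub_eq_zero.mp (hfinj _ ?_)
    rw [smul_sub, hθ', hDD, map_smul, sub_self]
  refine ⟨t ∘ₗ q ∘ₗ θ, LinearMap.ext fun v => ?_⟩
  have h1 := LinearMap.congr_fun hψ' v
  simp only [LinearMap.comp_apply] at h1 ⊢
  rw [← key, h1, hts]

/-- For a matrix factorization `D ∘ D = f`, the induced complex is exact after applying
`Hom(-, M)` with `M` of finite projective dimension over `A ⧸ (f)`. -/
theorem exists_eq_comp_of_projDimLE (hf : ∀ x : A, f * x = 0 → x = 0)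
    (hD : D ∘ₗ D = f • LinearMap.id) (n : ℕ) :
    ∀ (M : Type v) [AddCommGroup M] [Module A M] [Module (A ⧸ Ideal.span {f}) M]
      [IsScalarTower A (A ⧸ Ideal.span {f}) M], ProjDimLE (A ⧸ Ideal.span {f}) n M →
      ∀ ψ : V →ₗ[A] M, ψ ∘ₗ D = 0 → ∃ χ : V →ₗ[A] M, ψ = χ ∘ₗ D := by
  induction n with
  | zero =>
    intro M _ _ _ _ hM ψ hψ
    have : Module.Projective (A ⧸ Ideal.span {f}) M := hM
    exact exists_eq_comp_of_projective hf hD M ψ hψ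
  | succ n ih =>
    rintro M _ _ _ _ ⟨P, _, _, g, hP, hg, hK⟩ ψ hψ
    let : Module A P := Module.compHom P (algebraMap A (A ⧸ Ideal.span {f}))
    have : IsScalarTower A (A ⧸ Ideal.span {f}) P := .of_algebraMap_smul fun _ _ => rfl
    have hDD : ∀ v, D (D v) = f • v := fun v => LinearMap.congr_fun hD v
    have hfP : ∀ p : P, f • p = 0 := fun p => by
      rw [← algebraMap_smul (A ⧸ Ideal.span {f}) f p, Ideal.Quotient.algebraMap_eq,
        Ideal.Quotient.eq_zero_iff_mem.mpr (Ideal.mem_span_singleton_self f), zero_smul]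
    let g' : P →ₗ[A] M := g.restrictScalars A
    obtain ⟨ψ', hψ'⟩ := Module.projective_lifting_property g' ψ hg
    have hψg : ∀ v, g (ψ' v) = ψ v := fun v => LinearMap.congr_fun hψ' v
    have hker : ∀ v, ψ' (D v) ∈ LinearMap.ker g := fun v =>
      LinearMap.mem_ker.mpr ((hψg (D v)).trans (LinearMap.congr_fun hψ v))
    let modK : Module A (LinearMap.ker g) :=
      Module.compHom (LinearMap.ker g) (algebraMap A (A ⧸ Ideal.span {f}))
    let i : LinearMap.ker g →ₗ[A] P :=
      { toFun := Subtype.val, map_add' := fun _ _ => rfl, map_smul' := fun _ _ => rfl }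
    let ρ : V →ₗ[A] LinearMap.ker g :=
      { toFun := fun v => ⟨ψ' (D v), hker v⟩
        map_add' := fun v w => Subtype.ext (by simp)
        map_smul' := fun a v => Subtype.ext ((ψ' ∘ₗ D).map_smul a v) }
    obtain ⟨χ, hχ⟩ := @ih (LinearMap.ker g) _ modK _
      { smul_assoc := fun a q k => by rw [Algebra.smul_def, mul_smul]; rfl } hK ρ
      (LinearMap.ext fun v => Subtype.ext (by
        change ψ' (D (D v)) = 0
        rw [hDD, map_smul, hfP]))
    have hχ' : ∀ v, ψ' (D v) = i (χ (D v)) := fun v =>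
      congrArg Subtype.val (LinearMap.congr_fun hχ v)
    obtain ⟨θ, hθ⟩ := exists_eq_comp_of_projective hf hD P (ψ' - i ∘ₗ χ)
      (LinearMap.ext fun v => by simp [hχ'])
    refine ⟨g' ∘ₗ θ, LinearMap.ext fun v => ?_⟩
    have h1 : g (ψ' v - i (χ v)) = g (θ (D v)) := congrArg g (LinearMap.congr_fun hθ v)
    have h2 : g (i (χ v)) = 0 := (χ v).2
    rw [map_sub, hψg, h2, sub_zero] at h1
    exact h1

end Exactness

section ProjDimLE

variable {A : Type u} [CommRing A]

theorem ProjDimLE.of_linearEquiv {n : ℕ} {M N : Type v} [AddCommGroup M] [Module A M]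
    [AddCommGroup N] [Module A N] (e : M ≃ₗ[A] N) (h : ProjDimLE A n M) : ProjDimLE A n N := by
  cases n with
  | zero =>
    have : Module.Projective A M := h
    exact Module.Projective.of_equiv e
  | succ n =>
    obtain ⟨P, _, _, g, hP, hg, hK⟩ := h
    refine ⟨P, _, _, e.toLinearMap ∘ₗ g, hP, e.surjective.comp hg, ?_⟩
    rwa [LinearEquiv.ker_comp]

theorem ProjDimLE.prod {n : ℕ} {P L : Type v} [AddCommGroup P] [Module A P] [AddCommGroup L]
    [Module A L] [Module.Projective A P] (h : ProjDimLE A n L) : ProjDimLE A n (P × L) := by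
  cases n with
  | zero =>
    have : Module.Projective A L := h
    exact (inferInstance : Module.Projective A (P × L))
  | succ n =>
    obtain ⟨F, _, _, g, hF, hg, hK⟩ := h
    refine ⟨P × F, inferInstance, inferInstance, LinearMap.prodMap LinearMap.id g, inferInstance,
      Function.surjective_id.prodMap hg, hK.of_linearEquiv ?_⟩
    exact
      { toFun := fun x => ⟨(0, x), by simp⟩
        map_add' := fun x y => by ext <;> simp
        map_smul' := fun a x => by ext <;> simp
        invFun := fun y => ⟨y.1.2, (Prod.ext_iff.mp y.2).2⟩
        left_inv := fun x => rfl
        right_inv := fun y => Subtype.ext (Prod.ext (Prod.ext_iff.mp y.2).1.symm rfl) }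

/-- The cokernel of an injection between modules of projective dimension at most `n` has
projective dimension at most `n + 1`. -/
theorem ProjDimLE.of_injective_of_surjective_of_exact (n : ℕ) :
    ∀ {M N C : Type v} [AddCommGroup M] [Module A M] [AddCommGroup N] [Module A N]
      [AddCommGroup C] [Module A C] (i : M →ₗ[A] N) (p : N →ₗ[A] C),
      Function.Injective i → Function.Surjective p → LinearMap.range i = LinearMap.ker p →
      ProjDimLE A n M → ProjDimLE A n N → ProjDimLE A (n + 1) C := by
  induction n with
  | zero =>
    intro M N C _ _ _ _ _ _ i p hi hp hip hM hN
    refine ⟨N, _, _, p, hN, hp, ?_⟩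
    exact hM.of_linearEquiv ((LinearEquiv.ofInjective i hi).trans (LinearEquiv.ofEq _ _ hip))
  | succ n ih =>
    rintro M N C _ _ _ _ _ _ i p hi hp hip ⟨F, _, _, a, hF, ha, hKa⟩ ⟨G, _, _, b, hG, hb, hKb⟩
    refine ⟨G, _, _, p ∘ₗ b, hG, hp.comp hb, ?_⟩
    obtain ⟨t, ht⟩ := Module.projective_lifting_property b (i ∘ₗ a) hb
    have ht' : ∀ x, b (t x) = i (a x) := fun x => LinearMap.congr_fun ht x
    have hpi : ∀ x, p (i x) = 0 := fun x =>
      LinearMap.mem_ker.mp (hip ▸ LinearMap.mem_range_self i x)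
    let j : LinearMap.ker a →ₗ[A] F × LinearMap.ker b :=
      (LinearMap.ker a).subtype.prod
        ((-(t ∘ₗ (LinearMap.ker a).subtype)).codRestrict _ fun x => by simp [ht'])
    let q : F × LinearMap.ker b →ₗ[A] LinearMap.ker (p ∘ₗ b) :=
      (t.coprod (LinearMap.ker b).subtype).codRestrict _ fun x => by
        simp [ht', hpi]
    refine ih j q ?_ ?_ ?_ hKa hKb.prod
    · intro x y hxy
      exact Subtype.ext (Prod.ext_iff.mp hxy).1
    · rintro ⟨y, hy⟩
      have hby : b y ∈ LinearMap.range i := hip ▸ hy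
      obtain ⟨m, hm⟩ := hby
      obtain ⟨x, rfl⟩ := ha m
      exact ⟨(x, ⟨y - t x, by simp [ht', hm]⟩), Subtype.ext (add_sub_cancel (t x) y)⟩
    · ext ⟨x, y, hy⟩
      rw [LinearMap.mem_range, LinearMap.mem_ker]
      constructor
      · rintro ⟨z, hz⟩
        rw [← hz]
        exact Subtype.ext (add_neg_cancel (t z))
      · intro hz
        have hz' : t x + y = 0 := congrArg Subtype.val hz
        have hx : a x = 0 := hi (by
          rw [← ht', eq_neg_of_add_eq_zero_left hz', map_neg, LinearMap.mem_ker.mp hy, map_zero,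
            neg_zero])
        exact ⟨⟨x, hx⟩, Prod.ext rfl (Subtype.ext (eq_neg_of_add_eq_zero_right hz').symm)⟩

/-- Passing to the quotient by a regular element raises the projective dimension by at most one. -/
theorem ProjDimLE.quotient_of_isRegular {n : ℕ} {B C : Type v} [CommRing B] [CommRing C]
    [Algebra A B] [Algebra A C] (p : B →ₐ[A] C) (hp : Function.Surjective p) {x : B}
    (hx : ∀ y, x * y = 0 → y = 0) (hker : RingHom.ker p = Ideal.span {x})
    (h : ProjDimLE A n B) : ProjDimLE A (n + 1) C := by
  refine ProjDimLE.of_injective_of_surjective_of_exact n (LinearMap.mulLeft A x) p.toLinearMap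
    ?_ hp ?_ h h
  · exact (injective_iff_map_eq_zero _).mpr hx
  · ext y
    have : y ∈ RingHom.ker p ↔ y ∈ Ideal.span {x} := by rw [hker]
    rw [RingHom.mem_ker, Ideal.mem_span_singleton'] at this
    simp only [LinearMap.mem_range, LinearMap.mulLeft_apply, LinearMap.mem_ker,
      AlgHom.toLinearMap_apply, this, mul_comm]

end ProjDimLE

section QuotientByRegularSequence

variable {A : Type u} {B : Type v} [CommRing A] [CommRing B] [Algebra A B]

/-- If `B` is projective over `A` and `f, r₁, …, rₘ` is a weakly regular sequence on `B`, then
`B ⧸ (f, r₁, …, rₘ)` has finite projective dimension over `A ⧸ (f)`. -/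
theorem hasFinProjDim_quotient_of_isWeaklyRegular_cons [Module.Projective A B] (f : A)
    (rs : List B) :
    ∀ (I : Ideal B), I = Ideal.ofList (algebraMap A B f :: rs) →
      RingTheory.Sequence.IsWeaklyRegular B (algebraMap A B f :: rs) →
      ∀ ψ : A ⧸ Ideal.span {f} →+* B ⧸ I,
        ψ.comp (Ideal.Quotient.mk (Ideal.span {f})) =
          (Ideal.Quotient.mk I).comp (algebraMap A B) →
        @HasFinProjDim (A ⧸ Ideal.span {f}) _ (B ⧸ I) _ ψ.toModule := by
  induction rs using List.reverseRecOn with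
  | nil =>
    intro I hI _ ψ hψ
    have hI' : I = (Ideal.span {f}).map (algebraMap A B) := by
      rw [hI, Ideal.ofList_singleton, Ideal.map_span, Set.image_singleton]
    subst hI'
    have hψ' : ψ = algebraMap (A ⧸ Ideal.span {f})
        (B ⧸ (Ideal.span {f}).map (algebraMap A B)) := Ideal.Quotient.ringHom_ext hψ
    subst hψ'
    have : Module.Projective (A ⧸ Ideal.span {f}) (B ⧸ (Ideal.span {f}).map (algebraMap A B)) :=
      Module.Projective.of_equiv
        (Algebra.TensorProduct.quotIdealMapEquivQuotTensor B (Ideal.span {f})).symm.toLinearEquiv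
    have hmod : (algebraMap (A ⧸ Ideal.span {f})
        (B ⧸ (Ideal.span {f}).map (algebraMap A B))).toModule = Algebra.toModule :=
      Module.ext' _ _ fun x y => (Algebra.smul_def x y).symm
    rw [hmod]
    exact ⟨0, this⟩
  | append_singleton rs r ih =>
    intro I hI hreg ψ hψ
    rw [← List.cons_append] at hI hreg
    rw [RingTheory.Sequence.isWeaklyRegular_append_iff,
      RingTheory.Sequence.isWeaklyRegular_singleton_iff, smul_eq_mul, Ideal.mul_top] at hreg
    set I₀ : Ideal B := Ideal.ofList (algebraMap A B f :: rs) with hI₀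
    rw [Ideal.ofList_append, Ideal.ofList_singleton, ← hI₀] at hI
    have hle : I₀ ≤ I := hI ▸ le_sup_left
    have hf : Ideal.span {f} ≤ I₀.comap (algebraMap A B) := by
      rw [Ideal.span_singleton_le_iff_mem, Ideal.mem_comap, hI₀, Ideal.ofList_cons]
      exact Ideal.mem_sup_left (Ideal.mem_span_singleton_self _)
    let ψ₀ : A ⧸ Ideal.span {f} →+* B ⧸ I₀ := Ideal.quotientMap I₀ (algebraMap A B) hf
    obtain ⟨n, hn⟩ := ih I₀ hI₀ hreg.1 ψ₀ (Ideal.quotientMap_comp_mk hf)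
    let : Algebra (A ⧸ Ideal.span {f}) (B ⧸ I₀) := ψ₀.toAlgebra
    let : Algebra (A ⧸ Ideal.span {f}) (B ⧸ I) := ψ.toAlgebra
    let p : (B ⧸ I₀) →ₐ[A ⧸ Ideal.span {f}] (B ⧸ I) :=
      { Ideal.Quotient.factor hle with
        commutes' := fun x => by
          obtain ⟨a, rfl⟩ := Ideal.Quotient.mk_surjective x
          exact (RingHom.congr_fun hψ a).symm }
    refine ⟨n + 1, ProjDimLE.quotient_of_isRegular p (Ideal.Quotient.factor_surjective hle)
      (x := Ideal.Quotient.mk I₀ r) ?_ ?_ hn⟩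
    · intro y hy
      refine (isSMulRegular_iff_right_eq_zero_of_smul.mp hreg.2) y ?_
      rwa [Algebra.smul_def]
    · change RingHom.ker (Ideal.Quotient.factor hle) = _
      rw [Ideal.Quotient.factor_ker, hI, Ideal.map_sup, Ideal.map_quotient_self, bot_sup_eq,
        Ideal.map_span, Set.image_singleton]

end QuotientByRegularSequence

section Main

variable {A : Type u} {B : Type v} [CommRing A] [CommRing B] [IsLocalRing B] [Algebra A B]

theorem not_hasFinProjDim_of_mem_maximalIdeal_mul [IsLocalRing A] [Module.Free A B]
    (hmm : (maximalIdeal A).map (algebraMap A B) = maximalIdeal B) {J : Ideal B} (hJ : J ≠ ⊤)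
    {f : A} (hf : ∀ x : A, f * x = 0 → x = 0)
    (hfJ : algebraMap A B f ∈ maximalIdeal B * J)
    (ψ : A ⧸ Ideal.span {f} →+* B ⧸ J)
    (hψ : ψ.comp (Ideal.Quotient.mk (Ideal.span {f})) =
      (Ideal.Quotient.mk J).comp (algebraMap A B)) :
    ¬ @HasFinProjDim (A ⧸ Ideal.span {f}) _ (B ⧸ J) _ ψ.toModule := by
  have hJm : J ≤ maximalIdeal B := le_maximalIdeal hJ
  obtain ⟨ι, _, _, D, i₀, hD, hDm, hDJ⟩ := exists_matrix_mul_self_eq_smul_of_mem_mul hJm hfJ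
  let : Module (A ⧸ Ideal.span {f}) (B ⧸ J) := ψ.toModule
  have : IsScalarTower A (A ⧸ Ideal.span {f}) (B ⧸ J) := .of_algebraMap_smul fun a x => by
    change ψ (Ideal.Quotient.mk _ a) * x = a • x
    rw [Algebra.smul_def]
    exact congrArg (· * x) (RingHom.congr_fun hψ a)
  rintro ⟨n, hn⟩
  let δ : (ι → B) →ₗ[A] (ι → B) := D.mulVecLin.restrictScalars A
  have hδ : δ ∘ₗ δ = f • LinearMap.id := LinearMap.ext fun v => by
    change D.mulVec (D.mulVec v) = f • v
    rw [Matrix.mulVec_mulVec, hD, Matrix.smul_mulVec, Matrix.one_mulVec, algebraMap_smul]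
  let π : (ι → B) →ₗ[A] B ⧸ J := (Ideal.Quotient.mkₐ A J).toLinearMap ∘ₗ LinearMap.proj i₀
  obtain ⟨χ, hχ⟩ := exists_eq_comp_of_projDimLE hf hδ n (B ⧸ J) hn π
    (LinearMap.ext fun v => Ideal.Quotient.eq_zero_iff_mem.mpr
      (Ideal.sum_mem _ fun j _ => Ideal.mul_mem_right _ _ (hDJ j)))
  let ε : (ι → B) →ₗ[A] B ⧸ maximalIdeal B :=
    (Ideal.Quotient.factorₐ A hJm).toLinearMap ∘ₗ χ
  have hε : ∀ b ∈ maximalIdeal B, ∀ w, ε (b • w) = 0 := by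
    intro b hb w
    rw [← hmm] at hb
    induction hb using Submodule.span_induction generalizing w with
    | mem x hx =>
      obtain ⟨a, ha, rfl⟩ := hx
      rw [algebraMap_smul, map_smul, ← algebraMap_smul B a (ε w),
        Algebra.smul_def (algebraMap A B a), Ideal.Quotient.algebraMap_eq,
        Ideal.Quotient.eq_zero_iff_mem.mpr, zero_mul]
      exact hmm ▸ Ideal.mem_map_of_mem _ ha
    | zero => rw [zero_smul, map_zero]
    | add x y _ _ hx hy => rw [add_smul, map_add, hx, hy, add_zero]
    | smul c x _ hx => rw [smul_eq_mul, mul_comm, mul_smul, hx]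
  have hεδ : ∀ v, ε (δ v) = 0 := fun v => by
    rw [pi_eq_sum_univ (δ v), map_sum]
    exact Finset.sum_eq_zero fun i _ => hε _
      (Ideal.sum_mem _ fun j _ => Ideal.mul_mem_right _ _ (hDm i j)) _
  have h1 := hεδ 1
  change Ideal.Quotient.factor hJm (χ (δ 1)) = 0 at h1
  rw [← LinearMap.comp_apply, ← hχ] at h1
  exact one_ne_zero h1

theorem hasFinProjDim_of_notMem_maximalIdeal_mul [IsNoetherianRing B] [Module.Projective A B]
    {J : Ideal B} (rs : List B) (hrs : RingTheory.Sequence.IsRegular B rs)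
    (hJ : Ideal.ofList rs = J) {f : A} (hfJ : algebraMap A B f ∈ J)
    (hfmJ : algebraMap A B f ∉ maximalIdeal B * J)
    (ψ : A ⧸ Ideal.span {f} →+* B ⧸ J)
    (hψ : ψ.comp (Ideal.Quotient.mk (Ideal.span {f})) =
      (Ideal.Quotient.mk J).comp (algebraMap A B)) :
    @HasFinProjDim (A ⧸ Ideal.span {f}) _ (B ⧸ J) _ ψ.toModule := by
  have hJtop : J ≠ ⊤ := fun h => hrs.top_ne_smul (by simp [hJ, h])
  obtain ⟨r, rs', u, y, hperm, hu, hy, hf⟩ :=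
    Ideal.exists_perm_of_mem_ofList_of_notMem_mul rs (hJ ▸ hfJ) (hJ ▸ hfmJ)
  have hJ' : J = Ideal.ofList (algebraMap A B f :: rs') := by
    rw [← hf, Ideal.ofList_cons_eq_of_isUnit r rs' hu hy, Ideal.ofList_eq_of_perm hperm, hJ]
  refine hasFinProjDim_quotient_of_isWeaklyRegular_cons f rs' J hJ' ?_ ψ hψ
  have h1 := (IsLocalRing.isRegular_of_perm hrs
    (hperm.symm.trans (List.perm_append_singleton r rs').symm)).toIsWeaklyRegular
  have h2 : RingTheory.Sequence.IsWeaklyRegular B (rs' ++ [algebraMap A B f]) := by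
    rw [RingTheory.Sequence.isWeaklyRegular_append_iff,
      RingTheory.Sequence.isWeaklyRegular_singleton_iff, smul_eq_mul, Ideal.mul_top] at h1 ⊢
    refine ⟨h1.1, isSMulRegular_iff_right_eq_zero_of_smul.mpr fun x hx => ?_⟩
    refine isSMulRegular_iff_right_eq_zero_of_smul.mp h1.2 x (hu.smul_eq_zero.mp ?_)
    have hyx : y • x = 0 := by
      rw [Algebra.smul_def, Ideal.Quotient.algebraMap_eq, Ideal.Quotient.eq_zero_iff_mem.mpr hy,
        zero_mul]
    rwa [← hf, add_smul, hyx, add_zero, mul_smul] at hx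
  refine IsLocalRing.isWeaklyRegular_of_perm_of_subset_maximalIdeal h2
    (List.perm_append_singleton _ _) fun s hs => le_maximalIdeal hJtop ?_
  rw [hJ']
  exact Ideal.subset_span ((List.perm_append_singleton _ _).mem_iff.mp hs)

end Main

/-- **Lemma 2.5 (key lemma).** Let `φ : (Q,𝔪) → (Q',𝔪')` be a local homomorphism of regular
local rings making `Q'` a finite flat `Q`-module with `𝔪Q' = 𝔪'`.  Let `J ⊆ Q'` be an ideal
generated by a `Q'`-regular sequence and `f ∈ Q` nonzero with `φ(f) ∈ J`.  Then `Q'/J`,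
viewed as a module over `Q/(f)` via the ring map induced by `φ`, has finite projective
dimension over `Q/(f)` if and only if `φ(f) ∉ 𝔪'J`. -/
theorem stmt2 (Q : Type u) (Q' : Type v) [CommRing Q] [CommRing Q']
    [IsLocalRing Q] [IsLocalRing Q'] [IsNoetherianRing Q] [IsNoetherianRing Q']
    (hQ : IsRegularLocal Q) (hQ' : IsRegularLocal Q')
    [Algebra Q Q'] (hloc : IsLocalHom (algebraMap Q Q'))
    [Module.Finite Q Q'] [Module.Flat Q Q']
    (hmm : (maximalIdeal Q).map (algebraMap Q Q') = maximalIdeal Q')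
    (J : Ideal Q')
    (hJreg : ∃ rs : List Q', RingTheory.Sequence.IsRegular Q' rs ∧
      Ideal.span {r | r ∈ rs} = J)
    (f : Q) (hf0 : f ≠ 0) (hfJ : algebraMap Q Q' f ∈ J)
    (ψ : Q ⧸ Ideal.span {f} →+* Q' ⧸ J)
    (hψ : ψ.comp (Ideal.Quotient.mk (Ideal.span {f})) =
      (Ideal.Quotient.mk J).comp (algebraMap Q Q')) :
    @HasFinProjDim (Q ⧸ Ideal.span {f}) _ (Q' ⧸ J) _ ψ.toModule ↔
      algebraMap Q Q' f ∉ maximalIdeal Q' * J := by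
  have : IsDomain Q := hQ.isDomain
  have : Module.Free Q Q' := Module.free_of_flat_of_isLocalRing
  obtain ⟨rs, hrs, hJ⟩ := hJreg
  have hJtop : J ≠ ⊤ := fun h => hrs.top_ne_smul (by
    rw [smul_eq_mul, Ideal.mul_top]
    exact h.symm.trans hJ.symm)
  refine ⟨fun h hmem => ?_, fun h =>
    hasFinProjDim_of_notMem_maximalIdeal_mul rs hrs hJ hfJ h ψ hψ⟩
  exact not_hasFinProjDim_of_mem_maximalIdeal_mul hmm hJtop
    (fun x hx => (mul_eq_zero.mp hx).resolve_left hf0) hmem ψ hψ h
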